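/- Let n ≥ 2 and let g = (g_{ij}) and ḡ = (ḡ_{ij}) be smooth fields of symmetric invertible n×n matrices on an open set U ⊆ ℝ^n, with Christoffel symbols Γ and Γ̄ respectively (defined by Γ^k_{ij} = ½ Σ_l g^{kl}(∂_i g_{lj} + ∂_j g_{li} − ∂_l g_{ij}) and analogously for ḡ). Assume g and ḡ are projectively equivalent, i.e., there exists a smooth map α = (α_1,…,α_n) : U → ℝ^n such that Γ̄^a_{bc} − Γ^a_{bc} = δ^a_b α_c + δ^a_c α_b for all a,b,c. Define K_{ij} := |det(g)/det(ḡ)|^{2/(n+1)} · ḡ_{ij}. Then for every C² geodesic γ : I → U of Γ, the function t ↦ Σ_{i,j} K_{ij}(γ(t))·(γ^i)′(t)(γ^j)′(t) is constant on I. -/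

import Mathlib

/-- Partial derivative `∂_i f` of a function on `ℝ^n`. -/
noncomputable def pderiv' (n : ℕ) (f : (Fin n → ℝ) → ℝ) (i : Fin n) (p : Fin n → ℝ) : ℝ :=
  fderiv ℝ f p (Pi.single i 1)

/-- The Christoffel symbols `Γ^k_{ij} = ½ Σ_l g^{kl}(∂_i g_{lj} + ∂_j g_{li} − ∂_l g_{ij})`
of a field `g` of invertible symmetric matrices. -/
noncomputable def christoffel (n : ℕ) (g : (Fin n → ℝ) → Fin n → Fin n → ℝ)
    (k i j : Fin n) (p : Fin n → ℝ) : ℝ :=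
  (1 / 2) * ∑ l, (Matrix.of (g p))⁻¹ k l *
    (pderiv' n (fun q => g q l j) i p + pderiv' n (fun q => g q l i) j p
      - pderiv' n (fun q => g q i j) l p)

open Matrix in
/-- Jacobi's formula for the derivative of a determinant. -/
theorem hasDerivAt_det_of_entries {n : ℕ} {A : ℝ → Matrix (Fin n) (Fin n) ℝ}
    {A' : Matrix (Fin n) (Fin n) ℝ} {t : ℝ}
    (h : ∀ i j, HasDerivAt (fun τ => A τ i j) (A' i j) t) :
    HasDerivAt (fun τ => (A τ).det) ((A t).adjugate * A').trace t := by
  let D : ContinuousMultilinearMap ℝ (fun _ : Fin n => Fin n → ℝ) ℝ :=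
    { (detRowAlternating : (Fin n → ℝ) [⋀^Fin n]→ₗ[ℝ] ℝ).toMultilinearMap with
      cont := Continuous.matrix_det (A := fun M : Fin n → Fin n → ℝ => Matrix.of M)
        continuous_id }
  have hA : HasDerivAt (fun τ i => A τ i) (fun i => A' i) t :=
    hasDerivAt_pi.2 fun i => hasDerivAt_pi.2 fun j => h i j
  have key := (D.hasFDerivAt (fun i => A t i)).comp_hasDerivAt t hA
  refine key.congr_deriv ?_
  rw [ContinuousMultilinearMap.linearDeriv_apply, trace_mul_comm]
  refine Finset.sum_congr rfl fun i _ => ?_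
  change (updateRow (A t) i (A' i)).det = (A' * (A t).adjugate) i i
  rw [← cramer_transpose_apply, cramer_eq_adjugate_mulVec, ← adjugate_transpose, mul_apply]
  simp only [mulVec, dotProduct, transpose_apply]
  exact Finset.sum_congr rfl fun j _ => mul_comm _ _

theorem hasDerivAt_log_det {n : ℕ} {A : ℝ → Matrix (Fin n) (Fin n) ℝ}
    {A' : Matrix (Fin n) (Fin n) ℝ} {t : ℝ}
    (h : ∀ i j, HasDerivAt (fun τ => A τ i j) (A' i j) t) (hu : IsUnit (A t).det) :
    HasDerivAt (fun τ => Real.log (A τ).det) ((A t)⁻¹ * A').trace t := by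
  refine ((hasDerivAt_det_of_entries h).log hu.ne_zero).congr_deriv ?_
  rw [Matrix.inv_def, Ring.inverse_eq_inv', Matrix.smul_mul, Matrix.trace_smul, smul_eq_mul]
  ring

theorem hasDerivAt_comp_curve {n : ℕ} {f : (Fin n → ℝ) → ℝ} {γ : ℝ → Fin n → ℝ}
    {v : Fin n → ℝ} {t : ℝ} (hf : DifferentiableAt ℝ f (γ t))
    (hγ : ∀ k, HasDerivAt (fun τ => γ τ k) (v k) t) :
    HasDerivAt (fun τ => f (γ τ)) (∑ k, pderiv' n f k (γ t) * v k) t := by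
  refine (hf.hasFDerivAt.comp_hasDerivAt t (hasDerivAt_pi.2 hγ)).congr_deriv ?_
  rw [← ContinuousLinearMap.coe_coe, LinearMap.pi_apply_eq_sum_univ]
  refine Finset.sum_congr rfl fun k _ => ?_
  have hk : (fun j => if k = j then (1 : ℝ) else 0) = Pi.single k 1 := by
    ext j
    simp [Pi.single_apply, eq_comm]
  rw [smul_eq_mul, mul_comm, hk]
  rfl

theorem inv_symm {n : ℕ} {g : Fin n → Fin n → ℝ} (hs : ∀ i j, g i j = g j i) (i j : Fin n) :
    (Matrix.of g)⁻¹ i j = (Matrix.of g)⁻¹ j i := by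
  have h : (Matrix.of g).transpose = Matrix.of g := by
    ext a b
    exact hs b a
  rw [← Matrix.transpose_apply (Matrix.of g)⁻¹, Matrix.transpose_nonsing_inv, h]

/-- The contracted Christoffel symbols: `Γ^a_{ac} = ½ g^{al} ∂_c g_{la}`. -/
theorem sum_christoffel_self {n : ℕ} {g : (Fin n → ℝ) → Fin n → Fin n → ℝ} {p : Fin n → ℝ}
    (hs : ∀ i j, g p i j = g p j i) (c : Fin n) :
    ∑ a, christoffel n g a a c p =
      (1 / 2) * ∑ a, ∑ l, (Matrix.of (g p))⁻¹ a l * pderiv' n (fun q => g q l a) c p := by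
  have hswap : ∑ a, ∑ l, (Matrix.of (g p))⁻¹ a l * pderiv' n (fun q => g q l c) a p =
      ∑ a, ∑ l, (Matrix.of (g p))⁻¹ a l * pderiv' n (fun q => g q a c) l p := by
    rw [Finset.sum_comm]
    refine Finset.sum_congr rfl fun a _ => Finset.sum_congr rfl fun l _ => ?_
    rw [inv_symm hs]
  simp only [christoffel, ← Finset.mul_sum, mul_sub, mul_add, Finset.sum_sub_distrib,
    Finset.sum_add_distrib, hswap]
  ring

theorem trace_inv_mul_eq_sum_christoffel {n : ℕ} {g : (Fin n → ℝ) → Fin n → Fin n → ℝ}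
    {p : Fin n → ℝ} (hs : ∀ i j, g p i j = g p j i) (v : Fin n → ℝ) :
    ((Matrix.of (g p))⁻¹ *
        Matrix.of fun i j => ∑ k, pderiv' n (fun q => g q i j) k p * v k).trace =
      2 * ∑ c, (∑ a, christoffel n g a a c p) * v c := by
  simp only [sum_christoffel_self hs, Matrix.trace, Matrix.diag_apply, Matrix.mul_apply,
    Matrix.of_apply, Finset.mul_sum, Finset.sum_mul]
  rw [Finset.sum_comm' (t' := Finset.univ) (s' := fun _ => Finset.univ) (by simp)]
  conv_rhs => rw [Finset.sum_comm]
  rw [Finset.sum_comm]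
  refine Finset.sum_congr rfl fun a _ => ?_
  conv_rhs => rw [Finset.sum_comm]
  refine Finset.sum_congr rfl fun l _ => Finset.sum_congr rfl fun c _ => ?_
  ring

/-- Lowering the upper index of the Christoffel symbols. -/
theorem sum_mul_christoffel {n : ℕ} {g : (Fin n → ℝ) → Fin n → Fin n → ℝ} {p : Fin n → ℝ}
    (hs : ∀ i j, g p i j = g p j i) (hu : IsUnit (Matrix.of (g p)).det) (m k l : Fin n) :
    ∑ i, g p i m * christoffel n g i k l p =
      (1 / 2) * (pderiv' n (fun q => g q m l) k p + pderiv' n (fun q => g q m k) l p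
        - pderiv' n (fun q => g q k l) m p) := by
  set w : Fin n → ℝ := fun r => pderiv' n (fun q => g q r l) k p +
    pderiv' n (fun q => g q r k) l p - pderiv' n (fun q => g q k l) r p with hw
  have h : Matrix.mulVec (Matrix.of (g p)) (Matrix.mulVec (Matrix.of (g p))⁻¹ w) = w := by
    rw [Matrix.mulVec_mulVec, Matrix.mul_nonsing_inv _ hu, Matrix.one_mulVec]
  have hm := congrFun h m
  simp only [Matrix.mulVec, dotProduct, Matrix.of_apply] at hm
  change _ = 1 / 2 * w m
  rw [← hm, Finset.mul_sum]
  refine Finset.sum_congr rfl fun i _ => ?_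
  rw [hs i m, christoffel]
  ring

theorem sum_christoffel_contract {n : ℕ} {g : (Fin n → ℝ) → Fin n → Fin n → ℝ} {p : Fin n → ℝ}
    (hs : ∀ i j, g p i j = g p j i) (hu : IsUnit (Matrix.of (g p)).det) (v : Fin n → ℝ) :
    2 * ∑ i, ∑ j, g p i j * (∑ k, ∑ l, christoffel n g i k l p * v k * v l) * v j =
      ∑ i, ∑ j, (∑ k, pderiv' n (fun q => g q i j) k p * v k) * v i * v j := by
  have h1 : ∑ i, ∑ j, g p i j * (∑ k, ∑ l, christoffel n g i k l p * v k * v l) * v j =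
      ∑ j, ∑ k, ∑ l, (∑ i, g p i j * christoffel n g i k l p) * (v j * v k * v l) := by
    simp only [Finset.mul_sum, Finset.sum_mul]
    rw [Finset.sum_comm]
    refine Finset.sum_congr rfl fun j _ => ?_
    rw [Finset.sum_comm]
    refine Finset.sum_congr rfl fun k _ => ?_
    rw [Finset.sum_comm]
    refine Finset.sum_congr rfl fun l _ => Finset.sum_congr rfl fun i _ => ?_
    ring
  have h2 : ∑ j, ∑ k, ∑ l, pderiv' n (fun q => g q j l) k p * (v j * v k * v l) =
      ∑ i, ∑ j, ∑ k, pderiv' n (fun q => g q i j) k p * (v i * v j * v k) := by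
    refine Finset.sum_congr rfl fun j _ => ?_
    rw [Finset.sum_comm]
    refine Finset.sum_congr rfl fun k _ => Finset.sum_congr rfl fun l _ => ?_
    ring
  have h3 : ∑ j, ∑ k, ∑ l, pderiv' n (fun q => g q k l) j p * (v j * v k * v l) =
      ∑ i, ∑ j, ∑ k, pderiv' n (fun q => g q i j) k p * (v i * v j * v k) := by
    rw [Finset.sum_comm]
    refine Finset.sum_congr rfl fun j _ => ?_
    rw [Finset.sum_comm]
    refine Finset.sum_congr rfl fun k _ => Finset.sum_congr rfl fun l _ => ?_
    ring
  have h4 : ∑ i, ∑ j, (∑ k, pderiv' n (fun q => g q i j) k p * v k) * v i * v j =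
      ∑ i, ∑ j, ∑ k, pderiv' n (fun q => g q i j) k p * (v i * v j * v k) := by
    simp only [Finset.sum_mul]
    refine Finset.sum_congr rfl fun i _ => Finset.sum_congr rfl fun j _ =>
      Finset.sum_congr rfl fun k _ => ?_
    ring
  rw [h1, h4]
  simp only [sum_mul_christoffel hs hu, mul_assoc (1 / 2 : ℝ), ← Finset.mul_sum, sub_mul, add_mul,
    Finset.sum_sub_distrib, Finset.sum_add_distrib]
  rw [h2, h3]
  ring

/-- The derivative of `g(γ', γ')` along a curve is `2 g(∇γ', γ')`. -/
theorem hasDerivAt_metric_velocity {n : ℕ} {g : (Fin n → ℝ) → Fin n → Fin n → ℝ}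
    {γ γ' : ℝ → Fin n → ℝ} {a : Fin n → ℝ} {t : ℝ}
    (hg : ∀ i j, DifferentiableAt ℝ (fun q => g q i j) (γ t))
    (hs : ∀ i j, g (γ t) i j = g (γ t) j i) (hu : IsUnit (Matrix.of (g (γ t))).det)
    (hd1 : ∀ k, HasDerivAt (fun τ => γ τ k) (γ' t k) t)
    (hd2 : ∀ k, HasDerivAt (fun τ => γ' τ k) (a k) t) :
    HasDerivAt (fun τ => ∑ i, ∑ j, g (γ τ) i j * γ' τ i * γ' τ j)
      (2 * ∑ i, ∑ j, g (γ t) i j *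
        (a i + ∑ k, ∑ l, christoffel n g i k l (γ t) * γ' t k * γ' t l) * γ' t j) t := by
  have h := HasDerivAt.fun_sum (u := Finset.univ) fun i _ =>
    HasDerivAt.fun_sum (u := Finset.univ) fun j _ =>
      ((hasDerivAt_comp_curve (hg i j) hd1).mul (hd2 i)).mul (hd2 j)
  refine h.congr_deriv ?_
  have hsym : ∑ i, ∑ j, g (γ t) i j * γ' t i * a j = ∑ i, ∑ j, g (γ t) i j * a i * γ' t j := by
    rw [Finset.sum_comm]
    refine Finset.sum_congr rfl fun i _ => Finset.sum_congr rfl fun j _ => ?_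
    rw [hs j i]
    ring
  simp only [mul_add, add_mul, Finset.sum_add_distrib, Pi.mul_apply,
    sum_christoffel_contract hs hu, hsym]
  ring

/-- Tracing the projective equivalence relation. -/
theorem sum_christoffel_sub_of_projective {n : ℕ} {Γ' Γ : Fin n → Fin n → Fin n → ℝ}
    {α : Fin n → ℝ} (h : ∀ a b c, Γ' a b c - Γ a b c =
      (if a = b then 1 else 0) * α c + (if a = c then 1 else 0) * α b) (c : Fin n) :
    ∑ a, Γ' a a c - ∑ a, Γ a a c = (n + 1) * α c := by
  rw [← Finset.sum_sub_distrib]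
  simp only [h, Finset.sum_add_distrib, if_true, one_mul, Finset.sum_const, Finset.card_univ,
    Fintype.card_fin, nsmul_eq_mul, ite_mul, zero_mul, Finset.sum_ite_eq', Finset.mem_univ]
  ring

theorem contract_projective {n : ℕ} {Γ' Γ : Fin n → Fin n → Fin n → ℝ}
    {α : Fin n → ℝ} (h : ∀ a b c, Γ' a b c - Γ a b c =
      (if a = b then 1 else 0) * α c + (if a = c then 1 else 0) * α b)
    (v : Fin n → ℝ) (a : Fin n) :
    ∑ b, ∑ c, Γ' a b c * v b * v c =
      ∑ b, ∑ c, Γ a b c * v b * v c + 2 * (∑ c, α c * v c) * v a := by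
  have h' : ∀ b c, Γ' a b c * v b * v c = Γ a b c * v b * v c +
      ((if a = b then v b * (α c * v c) else 0) + (if a = c then α b * v b * v c else 0)) := by
    intro b c
    rw [eq_add_of_sub_eq (h a b c)]
    split_ifs <;> ring
  have h1 : ∑ b, ∑ c, (if a = b then v b * (α c * v c) else 0) = (∑ c, α c * v c) * v a := by
    rw [Finset.sum_comm]
    simp [Finset.mul_sum, mul_comm]
  simp only [h', Finset.sum_add_distrib, h1]
  simp only [Finset.sum_ite_eq, Finset.mem_univ, if_true, ← Finset.sum_mul]
  ring

/-- Topalov–Matveev: if `g` and `ḡ` are projectively equivalent metrics, then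
`K_{ij} = |det(g)/det(ḡ)|^{2/(n+1)} ḡ_{ij}` is a Killing tensor of `g`, i.e.
`K_{ij} ẋ^i ẋ^j` is constant along every geodesic of `g`. -/
theorem stmt_10 (n : ℕ) (hn : 2 ≤ n)
    (U : Set (Fin n → ℝ)) (hU : IsOpen U)
    (g gbar : (Fin n → ℝ) → Fin n → Fin n → ℝ)
    (hg_smooth : ∀ i j, ContDiffOn ℝ (⊤ : ℕ∞) (fun p => g p i j) U)
    (hg_symm : ∀ p ∈ U, ∀ i j, g p i j = g p j i)
    (hg_inv : ∀ p ∈ U, IsUnit (Matrix.of (g p)).det)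
    (hgbar_smooth : ∀ i j, ContDiffOn ℝ (⊤ : ℕ∞) (fun p => gbar p i j) U)
    (hgbar_symm : ∀ p ∈ U, ∀ i j, gbar p i j = gbar p j i)
    (hgbar_inv : ∀ p ∈ U, IsUnit (Matrix.of (gbar p)).det)
    (α : (Fin n → ℝ) → Fin n → ℝ)
    (hα_smooth : ∀ i, ContDiffOn ℝ (⊤ : ℕ∞) (fun p => α p i) U)
    (hpe : ∀ p ∈ U, ∀ a b c : Fin n,
      christoffel n gbar a b c p - christoffel n g a b c p =
        (if a = b then 1 else 0) * α p c + (if a = c then 1 else 0) * α p b)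
    (I : Set ℝ) (hIopen : IsOpen I) (hIconn : I.OrdConnected)
    (γ γ' γ'' : ℝ → Fin n → ℝ)
    (hmem : ∀ t ∈ I, γ t ∈ U)
    (hd1 : ∀ t ∈ I, ∀ k, HasDerivAt (fun τ => γ τ k) (γ' t k) t)
    (hd2 : ∀ t ∈ I, ∀ k, HasDerivAt (fun τ => γ' τ k) (γ'' t k) t)
    (hgeo : ∀ t ∈ I, ∀ k,
      γ'' t k + ∑ i, ∑ j, christoffel n g k i j (γ t) * γ' t i * γ' t j = 0) :
    ∀ t₁ ∈ I, ∀ t₂ ∈ I,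
      (∑ i, ∑ j,
          |(Matrix.of (g (γ t₁))).det / (Matrix.of (gbar (γ t₁))).det| ^ (2 / ((n : ℝ) + 1))
            * gbar (γ t₁) i j * γ' t₁ i * γ' t₁ j) =
      (∑ i, ∑ j,
          |(Matrix.of (g (γ t₂))).det / (Matrix.of (gbar (γ t₂))).det| ^ (2 / ((n : ℝ) + 1))
            * gbar (γ t₂) i j * γ' t₂ i * γ' t₂ j) := by
  set s : ℝ := 2 / ((n : ℝ) + 1) with hs
  have hn1 : (n : ℝ) + 1 ≠ 0 := by positivity
  set F : ℝ → ℝ := fun t => Real.exp (s * (Real.log (Matrix.of (g (γ t))).det -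
    Real.log (Matrix.of (gbar (γ t))).det)) *
      ∑ i, ∑ j, gbar (γ t) i j * γ' t i * γ' t j with hF
  have hK : ∀ t ∈ I, (∑ i, ∑ j,
      |(Matrix.of (g (γ t))).det / (Matrix.of (gbar (γ t))).det| ^ s
        * gbar (γ t) i j * γ' t i * γ' t j) = F t := by
    intro t ht
    have h1 := (hg_inv _ (hmem t ht)).ne_zero
    have h2 := (hgbar_inv _ (hmem t ht)).ne_zero
    rw [Real.rpow_def_of_pos (abs_pos.2 (div_ne_zero h1 h2)), Real.log_abs, Real.log_div h1 h2,
      mul_comm _ s]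
    simp only [hF, Finset.mul_sum, mul_assoc]
  have hderiv : ∀ t ∈ I, HasDerivAt F 0 t := by
    intro t ht
    have hp := hmem t ht
    have hdiff : ∀ {h : (Fin n → ℝ) → Fin n → Fin n → ℝ},
        (∀ i j, ContDiffOn ℝ (⊤ : ℕ∞) (fun p => h p i j) U) →
        ∀ i j, DifferentiableAt ℝ (fun q => h q i j) (γ t) := fun hh i j =>
      ((hh i j).contDiffAt (hU.mem_nhds hp)).differentiableAt (by simp)
    have hlog : ∀ {h : (Fin n → ℝ) → Fin n → Fin n → ℝ},
        (∀ i j, ContDiffOn ℝ (⊤ : ℕ∞) (fun p => h p i j) U) →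
        (∀ p ∈ U, ∀ i j, h p i j = h p j i) → (∀ p ∈ U, IsUnit (Matrix.of (h p)).det) →
        HasDerivAt (fun τ => Real.log (Matrix.of (h (γ τ))).det)
          (2 * ∑ c, (∑ a, christoffel n h a a c (γ t)) * γ' t c) t := fun {h} hh hsym hinv => by
      rw [← trace_inv_mul_eq_sum_christoffel (hsym _ hp)]
      exact hasDerivAt_log_det (A := fun τ => Matrix.of (h (γ τ)))
        (fun i j => hasDerivAt_comp_curve (hdiff hh i j) (hd1 t ht)) (hinv _ hp)
    have hQ := hasDerivAt_metric_velocity (hdiff hgbar_smooth) (hgbar_symm _ hp) (hgbar_inv _ hp)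
      (hd1 t ht) (hd2 t ht)
    have hE := (((hlog hg_smooth hg_symm hg_inv).sub
      (hlog hgbar_smooth hgbar_symm hgbar_inv)).const_mul s).exp
    refine (hE.mul hQ).congr_deriv ?_
    have hacc : ∀ i, γ'' t i + ∑ k, ∑ l, christoffel n gbar i k l (γ t) * γ' t k * γ' t l =
        2 * (∑ c, α (γ t) c * γ' t c) * γ' t i := by
      intro i
      rw [contract_projective (Γ' := fun a b c => christoffel n gbar a b c (γ t)) (hpe _ hp),
        ← add_assoc, hgeo t ht i, zero_add]
    have htr : ∑ c, (∑ a, christoffel n gbar a a c (γ t)) * γ' t c =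
        ∑ c, (∑ a, christoffel n g a a c (γ t)) * γ' t c +
          (n + 1) * ∑ c, α (γ t) c * γ' t c := by
      rw [Finset.mul_sum, ← Finset.sum_add_distrib]
      refine Finset.sum_congr rfl fun c _ => ?_
      rw [← mul_assoc, ← add_mul, ← sum_christoffel_sub_of_projective
        (Γ' := fun a b c => christoffel n gbar a b c (γ t)) (hpe _ hp) c]
      ring
    have hfac : ∑ i, ∑ j, gbar (γ t) i j * (2 * (∑ c, α (γ t) c * γ' t c) * γ' t i) * γ' t j =
        2 * (∑ c, α (γ t) c * γ' t c) * ∑ i, ∑ j, gbar (γ t) i j * γ' t i * γ' t j := by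
      simp only [Finset.mul_sum (Finset.univ : Finset (Fin n)) _ (2 * ∑ c, α (γ t) c * γ' t c)]
      refine Finset.sum_congr rfl fun i _ => Finset.sum_congr rfl fun j _ => ?_
      ring
    simp only [hacc, hfac, htr, hs, Pi.sub_apply]
    field_simp
    ring
  intro t₁ h₁ t₂ h₂
  rw [hK t₁ h₁, hK t₂ h₂]
  exact hIopen.is_const_of_deriv_eq_zero hIconn.isPreconnected
    (fun t ht => (hderiv t ht).differentiableAt.differentiableWithinAt)
    (fun t ht => (hderiv t ht).deriv) h₁ h₂
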